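/- Let G and H be graphs and D a dominating set of G □ H. If there exist two dominating sets S₁ and S₂ of G such that for every h ∈ V(H), at least one of S₁, S₂ is a minimal dominating set of G containing p_G(D ∩ G_h), then |D| ≥ γ(G)·γ(H). -/

import Mathlib

open SimpleGraph

/-- `D` is a dominating set of `G`: every vertex is in `D` or adjacent to a vertex of `D`. -/
def IsDomSet {V : Type*} (G : SimpleGraph V) (D : Set V) : Prop :=
  ∀ v : V, v ∈ D ∨ ∃ u ∈ D, G.Adj u v

/-- The domination number `γ(G)`: minimum size of a dominating set. -/
noncomputable def domNum {V : Type*} (G : SimpleGraph V) : ℕ :=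
  sInf {n : ℕ | ∃ D : Set V, IsDomSet G D ∧ D.ncard = n}

/-- `S` is a minimal dominating set of `G` containing `X`. -/
def IsMinDomContaining {V : Type*} (G : SimpleGraph V) (X S : Set V) : Prop :=
  IsDomSet G S ∧ X ⊆ S ∧ ∀ S' : Set V, X ⊆ S' → S' ⊂ S → ¬ IsDomSet G S'

/-- `y` is a private neighbor of `x` with respect to `S`: `y ∉ S` and `N(y) ∩ S = {x}`. -/
def IsPrivNbr {V : Type*} (G : SimpleGraph V) (S : Set V) (x y : V) : Prop :=
  y ∉ S ∧ G.neighborSet y ∩ S = {x}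

/-- Projection to `G` of the part of `D` in the `G`-layer at `h`. -/
def projLayer {V W : Type*} (D : Set (V × W)) (h : W) : Set V :=
  Prod.fst '' (D ∩ {p : V × W | p.2 = h})


/-- `x` is the unique element of `S` in the closed neighborhood of `y`. -/
def UniqDom {V : Type*} (G : SimpleGraph V) (S : Set V) (x y : V) : Prop :=
  ∀ u, (u ∈ S ∧ (u = y ∨ G.Adj u y)) ↔ u = x

/-- `T` dominates `A` in `H`. -/
def DomOn {W : Type*} (H : SimpleGraph W) (T A : Set W) : Prop :=
  ∀ h ∈ A, h ∈ T ∨ ∃ h' ∈ T, H.Adj h' h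

lemma mem_projLayer' {V W : Type*} (D : Set (V × W)) (h : W) (x : V) :
    x ∈ projLayer D h ↔ (x, h) ∈ D := by
  unfold projLayer
  constructor
  · rintro ⟨⟨a, b⟩, ⟨h1, h2⟩, h3⟩
    simp only [Set.mem_setOf_eq] at h2 h3
    subst h2 h3
    exact h1
  · intro hx
    exact ⟨(x, h), ⟨hx, rfl⟩, rfl⟩

lemma key_one {V W : Type*} (G : SimpleGraph V) (D : Set (V × W)) (S : Set V) (A : Set W)
    (hS : IsDomSet G S) (hA : ∀ h ∈ A, IsMinDomContaining G (projLayer D h) S)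
    (x : V) (hx : x ∈ S) : (∀ h ∈ A, (x, h) ∈ D) ∨ ∃ y, UniqDom G S x y := by
  by_cases hc : ∀ h ∈ A, (x, h) ∈ D
  · exact Or.inl hc
  right
  push Not at hc
  obtain ⟨h, hh, hxh⟩ := hc
  obtain ⟨-, h2, h3⟩ := hA h hh
  have h4 := h3 (S \ {x}) (fun u hu => ⟨h2 hu, fun hux => hxh (by
    rw [Set.mem_singleton_iff] at hux
    rw [← hux]
    exact (mem_projLayer' D h u).1 hu)⟩)
    ⟨Set.diff_subset, fun hsub => (hsub hx).2 rfl⟩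
  unfold IsDomSet at h4
  push Not at h4
  obtain ⟨y, hy1, hy2⟩ := h4
  have hu : ∀ u, (u ∈ S ∧ (u = y ∨ G.Adj u y)) → u = x := by
    rintro u ⟨hu, rfl | hadj⟩
    · by_contra hne
      exact hy1 ⟨hu, hne⟩
    · by_contra hne
      exact hy2 u ⟨hu, hne⟩ hadj
  refine ⟨y, fun u => ⟨hu u, ?_⟩⟩
  rintro rfl
  rcases hS y with h5 | ⟨v, hv, hvy⟩
  · have := hu y ⟨h5, Or.inl rfl⟩
    exact ⟨hx, Or.inl this.symm⟩
  · have := hu v ⟨hv, Or.inr hvy⟩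
    subst this
    exact ⟨hx, Or.inr hvy⟩

lemma key_two {V W : Type*} (G : SimpleGraph V) (H : SimpleGraph W) (D : Set (V × W))
    (hD : IsDomSet (G □ H) D) (S : Set V) (A : Set W)
    (hA : ∀ h ∈ A, ∀ x, (x, h) ∈ D → x ∈ S) (x y : V) (hxy : UniqDom G S x y) :
    DomOn H ({h | h ∈ A ∧ (x, h) ∈ D} ∪ {h | h ∉ A ∧ (y, h) ∈ D}) A := by
  intro h hh
  by_cases hxh : (x, h) ∈ D
  · exact Or.inl (Or.inl ⟨hh, hxh⟩)
  rcases hD (y, h) with h1 | ⟨⟨u, h'⟩, hu, hadj⟩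
  · have := (hxy y).1 ⟨hA h hh y h1, Or.inl rfl⟩
    subst this
    exact absurd h1 hxh
  · rw [SimpleGraph.boxProd_adj] at hadj
    rcases hadj with ⟨ha, he⟩ | ⟨ha, he⟩
    · simp only at ha he
      subst he
      have := (hxy u).1 ⟨hA h' hh u hu, Or.inr ha⟩
      subst this
      exact absurd hu hxh
    · simp only at ha he
      subst he
      right
      by_cases hA' : h' ∈ A
      · have := (hxy u).1 ⟨hA h' hA' u hu, Or.inl rfl⟩
        subst this
        exact ⟨h', Or.inl ⟨hA', hu⟩, ha⟩
      · exact ⟨h', Or.inr ⟨hA', hu⟩, ha⟩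

lemma DomOn.mono {W : Type*} {H : SimpleGraph W} {T T' A : Set W} (h : DomOn H T A)
    (hT : T ⊆ T') : DomOn H T' A := by
  intro a ha
  rcases h a ha with h1 | ⟨b, hb, hab⟩
  · exact Or.inl (hT h1)
  · exact Or.inr ⟨b, hT hb, hab⟩

lemma domNum_le_card {V : Type*} (G : SimpleGraph V) (T : Finset V)
    (hT : IsDomSet G (T : Set V)) : domNum G ≤ T.card :=
  Nat.sInf_le ⟨T, hT, Set.ncard_coe_finset T⟩

lemma exists_min_domOn {W : Type*} [Fintype W] (H : SimpleGraph W) (A : Set W) :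
    ∃ T : Finset W, DomOn H T A ∧ ∀ T' : Finset W, DomOn H T' A → T.card ≤ T'.card := by
  classical
  obtain ⟨T, hT, hmin⟩ := Finset.exists_min_image
    (Finset.univ.filter fun T : Finset W => DomOn H T A) Finset.card
    ⟨Finset.univ, by
      simp only [Finset.mem_filter, Finset.mem_univ, true_and]
      intro h _
      exact Or.inl (by simp)⟩
  exact ⟨T, (Finset.mem_filter.1 hT).2, fun T' hT' => hmin T' (by simpa using hT')⟩

lemma uniq_trans {V : Type*} {G : SimpleGraph V} {S : Set V} {x y z : V}
    (h : UniqDom G S x y) (hz : z ∈ S) (ha : z = y ∨ G.Adj z y) : z = x := (h z).1 ⟨hz, ha⟩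

lemma uniq_adj {V : Type*} {G : SimpleGraph V} {S : Set V} {x y : V}
    (h : UniqDom G S x y) : x = y ∨ G.Adj x y := ((h x).2 rfl).2

lemma count_fiber {V W : Type*} [Fintype V] [Fintype W] [DecidableEq V] [DecidableEq W]
    (E : Finset (V × W)) (S : Finset V) (C : V → Finset W)
    (hC : ∀ x ∈ S, ∀ h ∈ C x, (x, h) ∈ E) : ∑ x ∈ S, (C x).card ≤ E.card := by
  rw [← Finset.card_sigma]
  refine Finset.card_le_card_of_injOn (fun p => (p.1, p.2)) ?_ ?_
  · rintro ⟨x, h⟩ hp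
    simp only [Finset.coe_sigma, Set.mem_sigma_iff, Finset.mem_coe] at hp
    exact hC x hp.1 h hp.2
  · rintro ⟨x, h⟩ - ⟨x', h'⟩ - heq
    simp only [Prod.mk.injEq] at heq
    obtain ⟨rfl, rfl⟩ := heq
    rfl

theorem two_minimal_layers_bound {V W : Type*} [Fintype V] [Fintype W]
    (G : SimpleGraph V) (H : SimpleGraph W) (D : Set (V × W))
    (hD : IsDomSet (G □ H) D)
    (S₁ S₂ : Set V) (hS₁ : IsDomSet G S₁) (hS₂ : IsDomSet G S₂)
    (hmin : ∀ h : W, IsMinDomContaining G (projLayer D h) S₁ ∨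
      IsMinDomContaining G (projLayer D h) S₂) :
    D.ncard ≥ domNum G * domNum H := by
  classical
  set A : Set W := {h | IsMinDomContaining G (projLayer D h) S₁} with hAdef
  have hA1 : ∀ h ∈ A, IsMinDomContaining G (projLayer D h) S₁ := fun h hh => hh
  have hA2 : ∀ h ∈ Aᶜ, IsMinDomContaining G (projLayer D h) S₂ :=
    fun h hh => (hmin h).resolve_left hh
  have hsub1 : ∀ h ∈ A, ∀ x, (x, h) ∈ D → x ∈ S₁ :=
    fun h hh x hx => (hA1 h hh).2.1 ((mem_projLayer' D h x).2 hx)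
  have hsub2 : ∀ h ∈ Aᶜ, ∀ x, (x, h) ∈ D → x ∈ S₂ :=
    fun h hh x hx => (hA2 h hh).2.1 ((mem_projLayer' D h x).2 hx)
  clear_value A
  have hk1 := key_one G D S₁ A hS₁ hA1
  have hk2 := key_one G D S₂ Aᶜ hS₂ hA2
  have hd1 := key_two G H D hD S₁ A hsub1
  have hd2 := key_two G H D hD S₂ Aᶜ hsub2
  -- chosen private vertices
  have hf1 : ∃ f : V → V, ∀ x, (∃ y, UniqDom G S₁ x y) → UniqDom G S₁ x (f x) :=
    ⟨fun x => if h : ∃ y, UniqDom G S₁ x y then h.choose else x, fun x h => by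
      simp only [h, dif_pos]; exact h.choose_spec⟩
  have hf2 : ∃ f : V → V, ∀ x, (∃ y, UniqDom G S₂ x y) → UniqDom G S₂ x (f x) :=
    ⟨fun x => if h : ∃ y, UniqDom G S₂ x y then h.choose else x, fun x h => by
      simp only [h, dif_pos]; exact h.choose_spec⟩
  obtain ⟨f1, hf1⟩ := hf1
  obtain ⟨f2, hf2⟩ := hf2
  let C1 : V → Finset W := fun x => Finset.univ.filter fun h => h ∈ A ∧ (x, h) ∈ D
  let C2 : V → Finset W := fun x => Finset.univ.filter fun h => h ∉ A ∧ (x, h) ∈ D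
  have hC1 : ∀ x, (C1 x : Set W) = {h | h ∈ A ∧ (x, h) ∈ D} := by intro x; ext h; simp [C1]
  have hC2 : ∀ x, (C2 x : Set W) = {h | h ∉ A ∧ (x, h) ∈ D} := by intro x; ext h; simp [C2]
  have hd1' : ∀ x y, UniqDom G S₁ x y → DomOn H (C1 x ∪ C2 y : Set W) A := by
    intro x y hxy
    rw [hC1, hC2]
    exact hd1 x y hxy
  have hd2' : ∀ x y, UniqDom G S₂ y x → DomOn H (C1 x ∪ C2 y : Set W) Aᶜ := by
    intro x y hxy
    rw [hC1, hC2]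
    refine (hd2 y x hxy).mono ?_
    rintro h (h1 | h1)
    · exact Or.inr h1
    · exact Or.inl ⟨not_not.1 h1.1, h1.2⟩
  have he1 : ∀ x, x ∉ S₁ → C1 x = ∅ := by
    intro x hx
    ext h
    simp only [C1, Finset.mem_filter, Finset.mem_univ, true_and, Finset.notMem_empty, iff_false]
    exact fun hh => hx (hsub1 h hh.1 x hh.2)
  have he2 : ∀ x, x ∉ S₂ → C2 x = ∅ := by
    intro x hx
    ext h
    simp only [C2, Finset.mem_filter, Finset.mem_univ, true_and, Finset.notMem_empty, iff_false]
    exact fun hh => hx (hsub2 h hh.1 x hh.2)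
  -- either alone or matched
  have alone1 : ∀ x ∈ S₁, DomOn H (C1 x) A ∨ (f1 x ∈ S₂ ∧ UniqDom G S₁ x (f1 x)) := by
    intro x hx
    rcases hk1 x hx with h | h
    · left
      intro a ha
      exact Or.inl (by rw [hC1]; exact ⟨ha, h a ha⟩)
    · by_cases hy : f1 x ∈ S₂
      · exact Or.inr ⟨hy, hf1 x h⟩
      · left
        have := hd1' x (f1 x) (hf1 x h)
        rw [he2 _ hy] at this
        simpa using this
  have alone2 : ∀ y ∈ S₂, DomOn H (C2 y) Aᶜ ∨ (f2 y ∈ S₁ ∧ UniqDom G S₂ y (f2 y)) := by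
    intro x hx
    rcases hk2 x hx with h | h
    · left
      intro a ha
      exact Or.inl (by rw [hC2]; exact ⟨ha, h a ha⟩)
    · by_cases hy : f2 x ∈ S₁
      · exact Or.inr ⟨hy, hf2 x h⟩
      · left
        have := hd2' (f2 x) x (hf2 x h)
        rw [he1 _ hy] at this
        simpa using this
  let R : V × V → Prop := fun p => p.1 ∈ S₁ ∧ p.2 ∈ S₂ ∧
    ((UniqDom G S₁ p.1 p.2 ∧ p.2 = f1 p.1) ∨ (UniqDom G S₂ p.2 p.1 ∧ p.1 = f2 p.2))
  have sw : ∀ {a b : V}, (a = b ∨ G.Adj a b) → (b = a ∨ G.Adj b a) :=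
    fun h => h.imp Eq.symm (fun h => h.symm)
  have hRadj : ∀ x y, R (x, y) → x = y ∨ G.Adj x y := by
    rintro x y ⟨-, -, ⟨h, -⟩ | ⟨h, -⟩⟩
    · exact uniq_adj h
    · exact sw (uniq_adj h)
  have inj1 : ∀ x y y', R (x, y) → R (x, y') → y = y' := by
    intro x y y' h h'
    have ha := hRadj _ _ h
    have ha' := hRadj _ _ h'
    obtain ⟨hx, hy, h⟩ := h
    obtain ⟨-, hy', h'⟩ := h'
    rcases h with ⟨h, e⟩ | ⟨h, e⟩
    · rcases h' with ⟨h', e'⟩ | ⟨h', e'⟩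
      · exact e.trans e'.symm
      · exact uniq_trans h' hy (sw ha)
    · exact (uniq_trans h hy' (sw ha')).symm
  have inj2 : ∀ x x' y, R (x, y) → R (x', y) → x = x' := by
    intro x x' y h h'
    have ha := hRadj _ _ h
    have ha' := hRadj _ _ h'
    obtain ⟨hx, hy, h⟩ := h
    obtain ⟨hx', -, h'⟩ := h'
    rcases h with ⟨h, e⟩ | ⟨h, e⟩
    · exact (uniq_trans h hx' ha').symm
    · rcases h' with ⟨h', e'⟩ | ⟨h', e'⟩
      · exact uniq_trans h' hx ha
      · exact e.trans e'.symm
  have pairDom : ∀ x y, R (x, y) → IsDomSet H (C1 x ∪ C2 y : Set W) := by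
    intro x y hR
    have ha := hRadj _ _ hR
    obtain ⟨hx, hy, h⟩ := hR
    have h1 : DomOn H (C1 x ∪ C2 y : Set W) A := by
      rcases alone1 x hx with hal | ⟨hm, hu⟩
      · exact hal.mono Set.subset_union_left
      · rcases h with ⟨h, e⟩ | ⟨h, e⟩
        · exact hd1' x y h
        · have : f1 x = y := uniq_trans h hm (sw (uniq_adj hu))
          rw [this] at hu
          exact hd1' x y hu
    have h2 : DomOn H (C1 x ∪ C2 y : Set W) Aᶜ := by
      rcases alone2 y hy with hal | ⟨hm, hu⟩
      · exact hal.mono Set.subset_union_right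
      · rcases h with ⟨h, e⟩ | ⟨h, e⟩
        · have : f2 y = x := uniq_trans h hm (sw (uniq_adj hu))
          rw [this] at hu
          exact hd2' x y hu
        · exact hd2' x y h
    intro h
    by_cases hh : h ∈ A
    · exact h1 h hh
    · exact h2 h hh
  let M : Finset (V × V) := Finset.univ.filter R
  have hM : ∀ p, p ∈ M ↔ R p := by intro p; simp [M]
  have i1 : Set.InjOn Prod.fst (M : Set (V × V)) := by
    rintro ⟨x, y⟩ h ⟨x', y'⟩ h' (rfl : x = x')
    rw [inj1 x y y' ((hM _).1 h) ((hM _).1 h')]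
  have i2 : Set.InjOn Prod.snd (M : Set (V × V)) := by
    rintro ⟨x, y⟩ h ⟨x', y'⟩ h' (rfl : y = y')
    rw [inj2 x x' y ((hM _).1 h) ((hM _).1 h')]
  obtain ⟨T1, hT1, hmin1⟩ := exists_min_domOn H A
  obtain ⟨T2, hT2, hmin2⟩ := exists_min_domOn H Aᶜ
  have hT : domNum H ≤ T1.card + T2.card := by
    refine (domNum_le_card H (T1 ∪ T2) ?_).trans (Finset.card_union_le _ _)
    intro h
    rw [Finset.coe_union]
    by_cases hh : h ∈ A
    · exact hT1.mono Set.subset_union_left h hh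
    · exact hT2.mono Set.subset_union_right h hh
  let F1 : Finset V := S₁.toFinset
  let F2 : Finset V := S₂.toFinset
  have g1 : domNum G ≤ F1.card := domNum_le_card G F1 (by simpa [F1] using hS₁)
  have g2 : domNum G ≤ F2.card := domNum_le_card G F2 (by simpa [F2] using hS₂)
  have s1 : M.image Prod.fst ⊆ F1 := by
    intro x hx
    obtain ⟨p, hp, rfl⟩ := Finset.mem_image.1 hx
    simpa [F1] using ((hM p).1 hp).1
  have s2 : M.image Prod.snd ⊆ F2 := by
    intro x hx
    obtain ⟨p, hp, rfl⟩ := Finset.mem_image.1 hx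
    simpa [F2] using ((hM p).1 hp).2.1
  have c1 := Finset.card_sdiff_add_card_eq_card s1
  have c2 := Finset.card_sdiff_add_card_eq_card s2
  rw [Finset.card_image_of_injOn i1] at c1
  rw [Finset.card_image_of_injOn i2] at c2
  have sum1 := Finset.sum_sdiff (f := fun x => (C1 x).card) s1
  have sum2 := Finset.sum_sdiff (f := fun x => (C2 x).card) s2
  rw [Finset.sum_image i1] at sum1
  rw [Finset.sum_image i2] at sum2
  have l1 : (F1 \ M.image Prod.fst).card * T1.card ≤
      ∑ x ∈ F1 \ M.image Prod.fst, (C1 x).card := by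
    rw [← smul_eq_mul]
    refine Finset.card_nsmul_le_sum _ _ _ fun x hx => ?_
    obtain ⟨hx1, hx2⟩ := Finset.mem_sdiff.1 hx
    have hx1' : x ∈ S₁ := by simpa [F1] using hx1
    rcases alone1 x hx1' with h | ⟨h, hu⟩
    · exact hmin1 _ h
    · exact absurd (Finset.mem_image.2 ⟨(x, f1 x), (hM _).2 ⟨hx1', h, Or.inl ⟨hu, rfl⟩⟩, rfl⟩) hx2
  have l2 : (F2 \ M.image Prod.snd).card * T2.card ≤
      ∑ x ∈ F2 \ M.image Prod.snd, (C2 x).card := by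
    rw [← smul_eq_mul]
    refine Finset.card_nsmul_le_sum _ _ _ fun x hx => ?_
    obtain ⟨hx1, hx2⟩ := Finset.mem_sdiff.1 hx
    have hx1' : x ∈ S₂ := by simpa [F2] using hx1
    rcases alone2 x hx1' with h | ⟨h, hu⟩
    · exact hmin2 _ h
    · exact absurd (Finset.mem_image.2 ⟨(f2 x, x), (hM _).2 ⟨h, hx1', Or.inr ⟨hu, rfl⟩⟩, rfl⟩) hx2
  have l3 : M.card * domNum H ≤ ∑ p ∈ M, (C1 p.1).card + ∑ p ∈ M, (C2 p.2).card := by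
    rw [← Finset.sum_add_distrib, ← smul_eq_mul]
    refine Finset.card_nsmul_le_sum _ _ _ fun p hp => ?_
    refine (domNum_le_card H (C1 p.1 ∪ C2 p.2) ?_).trans (Finset.card_union_le _ _)
    rw [Finset.coe_union]
    exact pairDom p.1 p.2 ((hM _).1 hp)
  have t1 := count_fiber (D.toFinset.filter fun p => p.2 ∈ A) F1 C1 (by
    intro x _ h hh
    simp only [C1, Finset.mem_filter, Finset.mem_univ, true_and] at hh
    simp [hh.1, hh.2])
  have t2 := count_fiber (D.toFinset.filter fun p => ¬ p.2 ∈ A) F2 C2 (by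
    intro x _ h hh
    simp only [C2, Finset.mem_filter, Finset.mem_univ, true_and] at hh
    simp [hh.1, hh.2])
  have t3 := Finset.card_filter_add_card_filter_not (s := D.toFinset) (fun p => p.2 ∈ A)
  have t4 : D.ncard = D.toFinset.card := Set.ncard_eq_toFinset_card' D
  have tot : M.card * domNum H + (F1 \ M.image Prod.fst).card * T1.card +
      (F2 \ M.image Prod.snd).card * T2.card ≤ D.ncard := by
    omega
  refine le_trans ?_ tot
  generalize (F1 \ M.image Prod.fst).card = a at *
  generalize (F2 \ M.image Prod.snd).card = b at *
  by_cases hm : domNum G ≤ M.card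
  · have := Nat.mul_le_mul_right (domNum H) hm
    omega
  · obtain ⟨k, hk⟩ := Nat.exists_eq_add_of_le (le_of_not_ge hm)
    rw [hk]
    have ha : k ≤ a := by omega
    have hb : k ≤ b := by omega
    have q1 := Nat.mul_le_mul_right T1.card ha
    have q2 := Nat.mul_le_mul_right T2.card hb
    have q3 := Nat.mul_le_mul_left k hT
    rw [Nat.mul_add] at q3
    rw [Nat.add_mul]
    omega
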